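/- arXiv:2512.12096 — 2 statements merged into one kernel-verified Lean document; each statement's English description precedes it below -/
import Mathlib

section
/- Let R be an associative ring with identity and let (A,B) be a complete hereditary cotorsion pair in Mod R. Then for every object C of the derived category D(R) there exists a cohomologically ghost distinguished triangle C → Y' → X' → C⟦1⟧ in D(R) such that: X' is isomorphic in D(R) to a CE A complex, and Y' satisfies: for every s ∈ ℤ, H^s(Y') ∈ B, and for every A ∈ A and every s ∈ ℤ the canonical map δ_s : Hom_{D(R)}(S(A), Y'⟦s⟧) → Hom_R(A, H^s(Y')) is bijective. (Right half of the completeness part of Theorem 2.5.) -/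
open CategoryTheory Limits DerivedCategory Pretriangulated

noncomputable section

universe w u

variable {R : Type u} [Ring R]

def Ext1Zero [HasExt.{w} (ModuleCat.{u} R)] (A B : ModuleCat.{u} R) : Prop :=
  Subsingleton (Abelian.Ext A B 1)

def IsSES {K M N : ModuleCat.{u} R} (i : K ⟶ M) (p : M ⟶ N) : Prop :=
  Function.Injective i ∧ Function.Surjective p ∧ Function.Exact i p

def IsCotorsionPair [HasExt.{w} (ModuleCat.{u} R)] (A B : Set (ModuleCat.{u} R)) : Prop :=
  (∀ M : ModuleCat.{u} R, M ∈ A ↔ ∀ N ∈ B, Ext1Zero M N) ∧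
  (∀ N : ModuleCat.{u} R, N ∈ B ↔ ∀ M ∈ A, Ext1Zero M N)

def IsCompleteCP (A B : Set (ModuleCat.{u} R)) : Prop :=
  ∀ M : ModuleCat.{u} R,
    (∃ (B' A' : ModuleCat.{u} R) (i : B' ⟶ A') (p : A' ⟶ M),
      B' ∈ B ∧ A' ∈ A ∧ IsSES i p) ∧
    (∃ (B' A' : ModuleCat.{u} R) (i : M ⟶ B') (p : B' ⟶ A'),
      B' ∈ B ∧ A' ∈ A ∧ IsSES i p)

def IsHereditaryCP (A B : Set (ModuleCat.{u} R)) : Prop :=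
  (∀ (K A₁ A₂ : ModuleCat.{u} R) (i : K ⟶ A₁) (p : A₁ ⟶ A₂),
    A₁ ∈ A → A₂ ∈ A → IsSES i p → K ∈ A) ∧
  (∀ (B₁ B₂ K : ModuleCat.{u} R) (i : B₁ ⟶ B₂) (p : B₂ ⟶ K),
    B₁ ∈ B → B₂ ∈ B → IsSES i p → K ∈ B)

def IsCE (S : Set (ModuleCat.{u} R)) (W : CochainComplex (ModuleCat.{u} R) ℤ) : Prop :=
  ∀ s : ℤ, W.X s ∈ S ∧ W.cycles s ∈ S ∧ image (W.d (s-1) s) ∈ S ∧ W.homology s ∈ S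

variable [HasDerivedCategory.{w} (ModuleCat.{u} R)]

def GhostTriangle {X Y Z : DerivedCategory (ModuleCat.{u} R)}
    (f : X ⟶ Y) (g : Y ⟶ Z) (h : Z ⟶ X⟦(1:ℤ)⟧) : Prop :=
  (Triangle.mk f g h ∈ distTriang (DerivedCategory (ModuleCat.{u} R))) ∧
  ∀ s : ℤ,
    Function.Injective ((homologyFunctor (ModuleCat.{u} R) s).map f) ∧
    Function.Surjective ((homologyFunctor (ModuleCat.{u} R) s).map g) ∧
    Function.Exact ((homologyFunctor (ModuleCat.{u} R) s).map f)
      ((homologyFunctor (ModuleCat.{u} R) s).map g)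

def stalk (M : ModuleCat.{u} R) : DerivedCategory (ModuleCat.{u} R) :=
  DerivedCategory.Q.obj
    ((HomologicalComplex.single (ModuleCat.{u} R) (ComplexShape.up ℤ) 0).obj M)

def stalkHomologyIso (M : ModuleCat.{u} R) :
    (homologyFunctor (ModuleCat.{u} R) 0).obj (stalk M) ≅ M :=
  (homologyFunctorFactors (ModuleCat.{u} R) 0).app _ ≪≫
    (HomologicalComplex.homologyFunctorSingleIso (ModuleCat.{u} R) (ComplexShape.up ℤ) 0).app M

def shiftHomologyIso (X : DerivedCategory (ModuleCat.{u} R)) (s a a' : ℤ) (h : s + a = a') :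
    (homologyFunctor (ModuleCat.{u} R) a).obj (X⟦s⟧) ≅
      (homologyFunctor (ModuleCat.{u} R) a').obj X :=
  ((homologyFunctor (ModuleCat.{u} R) 0).shiftIso s a a' h).app X

def deltaMap (M : ModuleCat.{u} R) (X : DerivedCategory (ModuleCat.{u} R)) (s : ℤ)
    (f : stalk M ⟶ X⟦s⟧) : M ⟶ (homologyFunctor (ModuleCat.{u} R) s).obj X :=
  (stalkHomologyIso M).inv ≫ (homologyFunctor (ModuleCat.{u} R) 0).map f ≫
    (shiftHomologyIso X s 0 s (add_zero s)).hom

section Preenvelopes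

omit [HasDerivedCategory.{w} (ModuleCat.{u} R)]

theorem exists_lift_of_range_le {T K M : ModuleCat.{u} R} {i : K ⟶ M} (hi : Function.Injective i)
    (f : T ⟶ M) (hf : ∀ x, ∃ y, i y = f x) : ∃ g : T ⟶ K, g ≫ i = f := by
  choose φ hφ using hf
  refine ⟨ModuleCat.ofHom
    { toFun := φ
      map_add' := fun x y => hi (by simp [hφ])
      map_smul' := fun r x => hi (by simp [hφ]) }, ?_⟩
  ext x
  exact hφ x

theorem exists_desc_of_ker_le {M N T : ModuleCat.{u} R} {p : M ⟶ N} (hp : Function.Surjective p)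
    (f : M ⟶ T) (hf : ∀ x, p x = 0 → f x = 0) : ∃ g : N ⟶ T, p ≫ g = f := by
  have key : ∀ x y, p x = p y → f x = f y := fun x y hxy => by
    rw [← sub_eq_zero, ← map_sub]
    exact hf _ (by rw [map_sub, hxy, sub_self])
  choose σ hσ using hp
  refine ⟨ModuleCat.ofHom
    { toFun := fun y => f (σ y)
      map_add' := fun x y => by
        rw [← map_add]
        exact key _ _ (by simp [hσ])
      map_smul' := fun r x => by
        rw [RingHom.id_apply, ← map_smul]
        exact key _ _ (by simp [hσ]) }, ?_⟩
  ext x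
  exact key _ _ (hσ (p x))

namespace IsSES

variable {K M N T : ModuleCat.{u} R} {i : K ⟶ M} {p : M ⟶ N}

theorem zero (h : IsSES i p) : i ≫ p = 0 := by
  ext x
  exact (h.2.2 (i x)).2 ⟨x, rfl⟩

theorem apply_apply (h : IsSES i p) (x : K) : p (i x) = 0 :=
  (h.2.2 (i x)).2 ⟨x, rfl⟩

theorem shortExact (h : IsSES i p) : (ShortComplex.mk i p h.zero).ShortExact where
  exact := (ShortComplex.ShortExact.moduleCat_exact_iff_function_exact _).2 h.2.2
  mono_f := (ModuleCat.mono_iff_injective _).2 h.1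
  epi_g := (ModuleCat.epi_iff_surjective _).2 h.2.1

theorem of_shortExact {S : ShortComplex (ModuleCat.{u} R)} (h : S.ShortExact) :
    IsSES S.f S.g :=
  ⟨h.moduleCat_injective_f, h.moduleCat_surjective_g,
    (ShortComplex.ShortExact.moduleCat_exact_iff_function_exact _).1 h.exact⟩

theorem exists_lift (h : IsSES i p) (f : T ⟶ M) (hf : f ≫ p = 0) : ∃ g : T ⟶ K, g ≫ i = f :=
  exists_lift_of_range_le h.1 f fun x => (h.2.2 _).1 (ConcreteCategory.congr_hom hf x)

theorem exists_desc (h : IsSES i p) (f : M ⟶ T) (hf : i ≫ f = 0) : ∃ g : N ⟶ T, p ≫ g = f :=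
  exists_desc_of_ker_le h.2.1 f fun x hx => by
    obtain ⟨y, rfl⟩ := (h.2.2 x).1 hx
    exact ConcreteCategory.congr_hom hf y

theorem cokernel {i : K ⟶ M} (hi : Function.Injective i) : IsSES i (cokernel.π i) :=
  have : Mono i := (ModuleCat.mono_iff_injective i).2 hi
  of_shortExact (S := ShortComplex.mk i (cokernel.π i) (by simp))
    { exact := ShortComplex.exact_cokernel i }

theorem of_iso (e : M ≅ N) : IsSES (0 : ModuleCat.of R PUnit.{u + 1} ⟶ M) e.hom := by
  have : Mono (0 : ModuleCat.of R PUnit.{u + 1} ⟶ M) :=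
    (ModuleCat.mono_iff_injective _).2 fun x y _ => rfl
  exact of_shortExact (S := ShortComplex.mk _ e.hom zero_comp)
    { exact := (ShortComplex.exact_iff_mono _ rfl).2 (by dsimp; infer_instance) }

/-- The nine lemma, for the third row of a diagram whose columns and first two rows are
short exact. -/
theorem third_row {L M N L' M' N' L'' M'' N'' : ModuleCat.{u} R}
    {a : L ⟶ M} {b : M ⟶ N} {a' : L' ⟶ M'} {b' : M' ⟶ N'} {a'' : L'' ⟶ M''} {b'' : M'' ⟶ N''}
    {l : L ⟶ L'} {l' : L' ⟶ L''} {m : M ⟶ M'} {m' : M' ⟶ M''} {n : N ⟶ N'} {n' : N' ⟶ N''}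
    (hb : Function.Surjective b) (h' : IsSES a' b')
    (hl : IsSES l l') (hm : IsSES m m') (hn : IsSES n n')
    (exact_ab : ∀ x, b x = 0 → ∃ y, a y = x)
    (w₁ : a ≫ m = l ≫ a') (w₂ : b ≫ n = m ≫ b') (w₃ : a' ≫ m' = l' ≫ a'')
    (w₄ : b' ≫ n' = m' ≫ b'') : IsSES a'' b'' := by
  replace w₁ x : m (a x) = a' (l x) := ConcreteCategory.congr_hom w₁ x
  replace w₂ x : n (b x) = b' (m x) := ConcreteCategory.congr_hom w₂ x
  replace w₃ x : m' (a' x) = a'' (l' x) := ConcreteCategory.congr_hom w₃ x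
  replace w₄ x : n' (b' x) = b'' (m' x) := ConcreteCategory.congr_hom w₄ x
  refine ⟨?_, ?_, ?_⟩
  · rw [injective_iff_map_eq_zero]
    intro x hx
    obtain ⟨y, rfl⟩ := hl.2.1 x
    obtain ⟨z, hz⟩ := (hm.2.2 (a' y)).1 (by rw [w₃, hx])
    obtain ⟨t, rfl⟩ := exact_ab z (hn.1 (by rw [w₂, hz, h'.apply_apply, map_zero]))
    rw [w₁] at hz
    rw [← h'.1 hz, hl.apply_apply]
  · intro x
    obtain ⟨y, rfl⟩ := hn.2.1 x
    obtain ⟨z, rfl⟩ := h'.2.1 y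
    exact ⟨m' z, (w₄ z).symm⟩
  · intro x
    constructor
    · intro hx
      obtain ⟨y, rfl⟩ := hm.2.1 x
      obtain ⟨z, hz⟩ := (hn.2.2 (b' y)).1 (by rw [w₄, hx])
      obtain ⟨t, rfl⟩ := hb z
      rw [w₂] at hz
      obtain ⟨v, hv⟩ := (h'.2.2 (y - m t)).1 (by rw [map_sub, hz, sub_self])
      exact ⟨l' v, by rw [← w₃, hv, map_sub, hm.apply_apply, sub_zero]⟩
    · rintro ⟨y, rfl⟩
      obtain ⟨z, rfl⟩ := hl.2.1 y
      rw [← w₃, ← w₄, h'.apply_apply, map_zero]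

end IsSES

section Cotorsion

variable [HasExt.{w} (ModuleCat.{u} R)] {A B : Set (ModuleCat.{u} R)}

namespace IsCotorsionPair

variable {K M N T : ModuleCat.{u} R} {i : K ⟶ M} {p : M ⟶ N}

theorem exists_lift (hcp : IsCotorsionPair A B) (h : IsSES i p) (hK : K ∈ B) (hT : T ∈ A)
    (f : T ⟶ N) : ∃ g : T ⟶ M, g ≫ p = f := by
  have : Subsingleton (Abelian.Ext T K 1) := (hcp.1 T).1 hT K hK
  obtain ⟨x, hx⟩ := Abelian.Ext.covariant_sequence_exact₃ T h.shortExact (Abelian.Ext.mk₀ f)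
    (zero_add 1) (Subsingleton.elim _ _)
  obtain ⟨g, rfl⟩ := Abelian.Ext.addEquiv₀.symm.surjective x
  refine ⟨g, Abelian.Ext.addEquiv₀.symm.injective ?_⟩
  simpa using hx

theorem exists_extension (hcp : IsCotorsionPair A B) (h : IsSES i p) (hN : N ∈ A) (hT : T ∈ B)
    (f : K ⟶ T) : ∃ g : M ⟶ T, i ≫ g = f := by
  have : Subsingleton (Abelian.Ext N T 1) := (hcp.1 N).1 hN T hT
  obtain ⟨x, hx⟩ := Abelian.Ext.contravariant_sequence_exact₁ h.shortExact T (Abelian.Ext.mk₀ f)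
    (add_zero 1) (Subsingleton.elim _ _)
  obtain ⟨g, rfl⟩ := Abelian.Ext.addEquiv₀.symm.surjective x
  refine ⟨g, Abelian.Ext.addEquiv₀.symm.injective ?_⟩
  simpa using hx

theorem left_of_extension (hcp : IsCotorsionPair A B) (h : IsSES i p) (hK : K ∈ A) (hN : N ∈ A) :
    M ∈ A := by
  refine (hcp.1 M).2 fun T hT => ⟨fun x y => ?_⟩
  have : Subsingleton (Abelian.Ext N T 1) := (hcp.1 N).1 hN T hT
  have : Subsingleton (Abelian.Ext K T 1) := (hcp.1 K).1 hK T hT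
  rw [← sub_eq_zero]
  obtain ⟨z, hz⟩ := Abelian.Ext.contravariant_sequence_exact₂ h.shortExact T (x - y)
    (Subsingleton.elim _ _)
  rw [← hz, Subsingleton.elim z 0, Abelian.Ext.comp_zero]

theorem right_of_extension (hcp : IsCotorsionPair A B) (h : IsSES i p) (hK : K ∈ B) (hN : N ∈ B) :
    M ∈ B := by
  refine (hcp.2 M).2 fun T hT => ⟨fun x y => ?_⟩
  have : Subsingleton (Abelian.Ext T N 1) := (hcp.1 T).1 hT N hN
  have : Subsingleton (Abelian.Ext T K 1) := (hcp.1 T).1 hT K hK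
  rw [← sub_eq_zero]
  obtain ⟨z, hz⟩ := Abelian.Ext.covariant_sequence_exact₂ T h.shortExact (x - y)
    (Subsingleton.elim _ _)
  rw [← hz, Subsingleton.elim z 0, Abelian.Ext.zero_comp]

theorem mem_left_of_projective (hcp : IsCotorsionPair A B) [Projective M] : M ∈ A :=
  (hcp.1 M).2 fun T _ => Abelian.Ext.subsingleton_of_projective M T 0

theorem mem_right_of_injective (hcp : IsCotorsionPair A B) [Injective M] : M ∈ B :=
  (hcp.2 M).2 fun T _ => Abelian.Ext.subsingleton_of_injective T M 0

theorem mem_left_of_isZero (hcp : IsCotorsionPair A B) (hM : IsZero M) : M ∈ A :=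
  have := hM.projective
  hcp.mem_left_of_projective

theorem mem_left_of_iso (hcp : IsCotorsionPair A B) (e : M ≅ N) (hN : N ∈ A) : M ∈ A :=
  hcp.left_of_extension (IsSES.of_iso e)
    (hcp.mem_left_of_isZero (ModuleCat.isZero_of_subsingleton _)) hN

theorem mem_right_of_iso (hcp : IsCotorsionPair A B) (e : M ≅ N) (hN : N ∈ B) : M ∈ B :=
  have := (ModuleCat.isZero_of_subsingleton (ModuleCat.of R PUnit.{u + 1})).injective
  hcp.right_of_extension (IsSES.of_iso e) hcp.mem_right_of_injective hN

/-- The horseshoe lemma for special preenvelopes. -/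
theorem horseshoe (hcp : IsCotorsionPair A B) (hhered : IsHereditaryCP A B)
    {L M N L' N' L'' N'' : ModuleCat.{u} R} {a : L ⟶ M} {b : M ⟶ N} (h : IsSES a b)
    {l : L ⟶ L'} {l' : L' ⟶ L''} (hl : IsSES l l') {n : N ⟶ N'} {n' : N' ⟶ N''}
    (hn : IsSES n n') (hL' : L' ∈ B) (hN'' : N'' ∈ A) :
    ∃ (M' M'' : ModuleCat.{u} R) (m : M ⟶ M') (m' : M' ⟶ M'') (a' : L' ⟶ M') (b' : M' ⟶ N')
      (a'' : L'' ⟶ M'') (b'' : M'' ⟶ N''),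
      IsSES m m' ∧ IsSES a' b' ∧ IsSES a'' b'' ∧ a ≫ m = l ≫ a' ∧ b ≫ n = m ≫ b' ∧
      a' ≫ m' = l' ≫ a'' ∧ b' ≫ n' = m' ≫ b'' := by
  obtain ⟨E, e, _, _⟩ : ∃ (E : ModuleCat.{u} R) (e : L' ⟶ E), Injective E ∧ Mono e :=
    ⟨_, Injective.ι L', inferInstance, inferInstance⟩
  let q := cokernel.π e
  have he : IsSES e q := IsSES.cokernel ((ModuleCat.mono_iff_injective _).1 inferInstance)
  have hQ : cokernel e ∈ B :=
    hhered.2 _ _ _ e q hL' hcp.mem_right_of_injective he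
  have : Mono a := (ModuleCat.mono_iff_injective a).2 h.1
  let α : M ⟶ E := Injective.factorThru (l ≫ e) a
  have hα : a ≫ α = l ≫ e := Injective.comp_factorThru _ _
  obtain ⟨β, hβ⟩ := h.exists_desc (α ≫ q) (by rw [reassoc_of% hα, he.zero, comp_zero])
  obtain ⟨ψ, hψ⟩ := hcp.exists_extension hn hN'' hQ β
  let S : Submodule R (E × N') :=
    LinearMap.ker (q.hom.coprod (-ψ.hom))
  have hS (x : E × N') : x ∈ S ↔ q x.1 = ψ x.2 := by
    simp [S, ← sub_eq_add_neg, sub_eq_zero]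
  let m : M ⟶ ModuleCat.of R S := ModuleCat.ofHom
    ((α.hom.prod (n.hom ∘ₗ b.hom)).codRestrict S fun x => by
      rw [hS]
      exact ((ConcreteCategory.congr_hom hβ x).symm.trans
        (congrArg (fun f : N ⟶ cokernel e => f (b x)) hψ.symm)))
  let a' : L' ⟶ ModuleCat.of R S := ModuleCat.ofHom
    ((e.hom.prod 0).codRestrict S fun x => by
      rw [hS]
      simpa using he.apply_apply x)
  let b' : ModuleCat.of R S ⟶ N' := ModuleCat.ofHom (LinearMap.snd R _ _ ∘ₗ S.subtype)
  have h' : IsSES a' b' := by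
    refine ⟨fun x y hxy => he.1 (congrArg (fun z : S => z.1.1) hxy), fun x => ?_, ?_⟩
    · obtain ⟨y, hy⟩ := he.2.1 (ψ x)
      exact ⟨⟨(y, x), (hS _).2 hy⟩, rfl⟩
    · rintro ⟨⟨x, y⟩, hxy⟩
      constructor
      · rintro (rfl : y = 0)
        obtain ⟨z, rfl⟩ := (he.2.2 x).1 (by simpa using (hS _).1 hxy)
        exact ⟨z, rfl⟩
      · rintro ⟨z, hz⟩
        exact (congrArg (fun z : S => z.1.2) hz).symm
  have w₁ : a ≫ m = l ≫ a' := by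
    ext x
    · exact ConcreteCategory.congr_hom hα x
    · exact (congrArg n (h.apply_apply x)).trans (map_zero n.hom)
  have w₂ : b ≫ n = m ≫ b' := rfl
  have hm : Function.Injective m := by
    change Function.Injective m.hom
    rw [injective_iff_map_eq_zero]
    intro x hx
    have h₁ : α x = 0 := congrArg (fun z : S => z.1.1) hx
    have h₂ : n (b x) = 0 := congrArg (fun z : S => z.1.2) hx
    obtain ⟨y, rfl⟩ := (h.2.2 x).1 (hn.1 (h₂.trans (map_zero n.hom).symm))
    have h₃ : e (l y) = 0 := (ConcreteCategory.congr_hom hα y).symm.trans h₁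
    have h₄ : l y = 0 := he.1 (h₃.trans (map_zero e.hom).symm)
    have h₅ : y = 0 := hl.1 (h₄.trans (map_zero l.hom).symm)
    rw [h₅, map_zero]
  have hm' := IsSES.cokernel hm
  obtain ⟨a'', ha''⟩ := hl.exists_desc (a' ≫ cokernel.π m)
    (by rw [← reassoc_of% w₁, cokernel.condition, comp_zero])
  obtain ⟨b'', hb''⟩ := hm'.exists_desc (b' ≫ n')
    (by rw [← reassoc_of% w₂, hn.zero, comp_zero])
  exact ⟨_, _, m, cokernel.π m, a', b', a'', b'', hm', h',
    IsSES.third_row h.2.1 h' hl hm' hn (fun x => (h.2.2 x).1) w₁ w₂ ha''.symm hb''.symm,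
    w₁, w₂, ha''.symm, hb''.symm⟩

end IsCotorsionPair

end Cotorsion

end Preenvelopes

section CartanEilenberg

omit [HasDerivedCategory.{w} (ModuleCat.{u} R)]

/-- Left homology data of a short complex from a presentation of its boundaries, cycles and
cohomology. -/
def leftHomologyDataOfIsSES {S : ShortComplex (ModuleCat.{u} R)} {B Z H : ModuleCat.{u} R}
    {i : B ⟶ Z} {π : Z ⟶ H} {j : Z ⟶ S.X₂} (hj : Function.Injective j)
    (hjg : Function.Exact j S.g) (hiπ : IsSES i π)
    (hf : ∃ e : S.X₁ ⟶ B, Function.Surjective e ∧ e ≫ i ≫ j = S.f) : S.LeftHomologyData := by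
  have : Mono j := (ModuleCat.mono_iff_injective _).2 hj
  have : Epi π := (ModuleCat.epi_iff_surjective _).2 hiπ.2.1
  have wi : j ≫ S.g = 0 := by
    ext x
    exact (hjg _).2 ⟨x, rfl⟩
  have hjex : (ShortComplex.mk j S.g wi).Exact :=
    (ShortComplex.ShortExact.moduleCat_exact_iff_function_exact _).2 hjg
  have hlift : hjex.fIsKernel.lift (KernelFork.ofι _ S.zero) ≫ j = S.f :=
    Fork.IsLimit.lift_ι hjex.fIsKernel
  have hfac : ∃ e : S.X₁ ⟶ B, Function.Surjective e ∧
      e ≫ i = hjex.fIsKernel.lift (KernelFork.ofι _ S.zero) := by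
    obtain ⟨e, he, hde⟩ := hf
    refine ⟨e, he, ?_⟩
    rw [← cancel_mono j, hlift, Category.assoc]
    exact hde
  have wπ : hjex.fIsKernel.lift (KernelFork.ofι _ S.zero) ≫ π = 0 := by
    obtain ⟨e, -, he⟩ := hfac
    rw [← he, Category.assoc, hiπ.zero, comp_zero]
  have hπ : (ShortComplex.mk _ π wπ).Exact := by
    rw [ShortComplex.moduleCat_exact_iff]
    intro x hx
    obtain ⟨y, rfl⟩ := (hiπ.2.2 x).1 hx
    obtain ⟨e, he', he⟩ := hfac
    obtain ⟨z, rfl⟩ := he' y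
    exact ⟨z, (ConcreteCategory.congr_hom he z).symm⟩
  exact
    { K := Z
      H := H
      i := j
      π := π
      wi := wi
      hi := hjex.fIsKernel
      wπ := wπ
      hπ := hπ.gIsCokernel }

theorem homologyMap_eq_of_leftHomologyData {S S' : ShortComplex (ModuleCat.{u} R)} (φ : S ⟶ S')
    (h : S.LeftHomologyData) (h' : S'.LeftHomologyData) (φK : h.K ⟶ h'.K) (φH : h.H ⟶ h'.H)
    (hi : φK ≫ h'.i = h.i ≫ φ.τ₂) (hπ : h.π ≫ φH = φK ≫ h'.π) :
    ShortComplex.homologyMap φ = h.homologyIso.hom ≫ φH ≫ h'.homologyIso.inv := by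
  let γ : ShortComplex.LeftHomologyMapData φ h h' :=
    { φK := φK
      φH := φH
      commi := hi
      commf' := by simp [← cancel_mono h'.i, hi, φ.comm₁₂]
      commπ := hπ }
  exact γ.homologyMap_eq

/-- Boundaries, cycles and cohomology of a cochain complex, presented by short exact sequences
`0 → B s → Z s → H s → 0` and `0 → Z s → W.X s → B (s + 1) → 0`. -/
structure CEData (W : CochainComplex (ModuleCat.{u} R) ℤ) where
  B : ℤ → ModuleCat.{u} R
  Z : ℤ → ModuleCat.{u} R
  H : ℤ → ModuleCat.{u} R
  i (s : ℤ) : B s ⟶ Z s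
  π (s : ℤ) : Z s ⟶ H s
  j (s : ℤ) : Z s ⟶ W.X s
  p (s : ℤ) : W.X s ⟶ B (s + 1)
  ses_iπ (s : ℤ) : IsSES (i s) (π s)
  ses_jp (s : ℤ) : IsSES (j s) (p s)
  d_eq (s : ℤ) : W.d s (s + 1) = p s ≫ i (s + 1) ≫ j (s + 1)

namespace CEData

variable {W W' : CochainComplex (ModuleCat.{u} R) ℤ} (D : CEData W) (D' : CEData W')

/-- The boundaries, cycles and cohomology of a cochain complex. -/
def canonical (C : CochainComplex (ModuleCat.{u} R) ℤ) : CEData C where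
  B s := kernel (C.homologyπ s)
  Z s := C.cycles s
  H s := C.homology s
  i s := kernel.ι _
  π s := C.homologyπ s
  j s := C.iCycles s
  p s := kernel.lift _ (C.toCycles s (s + 1)) (by simp)
  ses_iπ s := IsSES.of_shortExact (S := ShortComplex.mk _ _ (kernel.condition (C.homologyπ s)))
    { exact := ShortComplex.exact_kernel _ }
  ses_jp s := by
    have hker : (ShortComplex.mk (C.iCycles s) (C.d s (s + 1)) (by simp)).Exact :=
      ShortComplex.exact_of_f_is_kernel _ (C.cyclesIsKernel s (s + 1) (by simp))
    have hcoker : (ShortComplex.mk (C.toCycles s (s + 1)) (C.homologyπ (s + 1))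
        (by simp)).Exact :=
      ShortComplex.exact_of_g_is_cokernel _ (C.homologyIsCokernel s (s + 1) (by simp))
    rw [ShortComplex.moduleCat_exact_iff] at hker hcoker
    have hι : Function.Injective (kernel.ι (C.homologyπ (s + 1))) :=
      (ModuleCat.mono_iff_injective _).1 inferInstance
    have hp (x : C.X s) : kernel.ι (C.homologyπ (s + 1)) (kernel.lift _ (C.toCycles s (s + 1))
        (by simp) x) = C.toCycles s (s + 1) x :=
      ConcreteCategory.congr_hom (kernel.lift_ι (C.homologyπ (s + 1)) _ _) x
    have hd (x : C.X s) : C.iCycles (s + 1) (C.toCycles s (s + 1) x) = C.d s (s + 1) x :=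
      ConcreteCategory.congr_hom (C.toCycles_i s (s + 1)) x
    refine ⟨(ModuleCat.mono_iff_injective _).1 inferInstance, fun x => ?_, fun x => ⟨?_, ?_⟩⟩
    · obtain ⟨y, hy⟩ := hcoker (kernel.ι (C.homologyπ (s + 1)) x)
        (ConcreteCategory.congr_hom (kernel.condition (C.homologyπ (s + 1))) x)
      exact ⟨y, hι ((hp y).trans hy)⟩
    · intro hx
      exact hker x (by rw [← hd, ← hp, hx]; simp)
    · rintro ⟨y, rfl⟩
      have hi : Function.Injective (C.iCycles (s + 1)) :=
        (ModuleCat.mono_iff_injective _).1 inferInstance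
      apply hι
      apply hi
      rw [hp, hd]
      exact (ConcreteCategory.congr_hom (C.iCycles_d s (s + 1)) y).trans (by simp)
  d_eq s := by simp

theorem i_injective (s : ℤ) : Function.Injective (D.i s) := (D.ses_iπ s).1

theorem j_injective (s : ℤ) : Function.Injective (D.j s) := (D.ses_jp s).1

theorem exists_factorization {r s : ℤ} (hr : r + 1 = s) :
    ∃ e : W.X r ⟶ D.B s, Function.Surjective e ∧ e ≫ D.i s ≫ D.j s = W.d r s := by
  subst hr
  exact ⟨D.p r, (D.ses_jp r).2.1, (D.d_eq r).symm⟩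

theorem exact_j_d {s t : ℤ} (ht : s + 1 = t) : Function.Exact (D.j s) (W.d s t) := by
  subst ht
  intro x
  rw [← (D.ses_jp s).2.2 x, D.d_eq]
  constructor
  · intro hx
    exact D.i_injective _ (D.j_injective _ (hx.trans (by simp)))
  · intro hx
    simp [hx]

/-- The left homology data attached to the boundaries, cycles and cohomology. -/
def leftHomologyData (s : ℤ) : (W.sc s).LeftHomologyData :=
  leftHomologyDataOfIsSES (S := W.sc s) (D.j_injective s)
    (D.exact_j_d (show s + 1 = (ComplexShape.up ℤ).next s by simp)) (D.ses_iπ s)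
    (D.exists_factorization (show (ComplexShape.up ℤ).prev s + 1 = s by simp))

/-- The identification of the cohomology. -/
def homologyIso (s : ℤ) : W.homology s ≅ D.H s :=
  (D.leftHomologyData s).homologyIso

/-- The identification of the cycles. -/
def cyclesIso (s : ℤ) : W.cycles s ≅ D.Z s :=
  (D.leftHomologyData s).cyclesIso

theorem homologyMap_eq (φ : W ⟶ W') (s : ℤ) (φZ : D.Z s ⟶ D'.Z s) (φH : D.H s ⟶ D'.H s)
    (hj : D.j s ≫ φ.f s = φZ ≫ D'.j s) (hπ : D.π s ≫ φH = φZ ≫ D'.π s) :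
    HomologicalComplex.homologyMap φ s =
      (D.homologyIso s).hom ≫ φH ≫ (D'.homologyIso s).inv :=
  homologyMap_eq_of_leftHomologyData ((HomologicalComplex.shortComplexFunctor _ _ s).map φ)
    (D.leftHomologyData s) (D'.leftHomologyData s) φZ φH hj.symm hπ

theorem isCE [HasExt.{w} (ModuleCat.{u} R)] {A B : Set (ModuleCat.{u} R)}
    (hcp : IsCotorsionPair A B) (hB : ∀ s, D.B s ∈ A) (hH : ∀ s, D.H s ∈ A) : IsCE A W := by
  have hZ (s : ℤ) : D.Z s ∈ A := hcp.left_of_extension (D.ses_iπ s) (hB s) (hH s)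
  refine fun s => ⟨hcp.left_of_extension (D.ses_jp s) (hZ s) (hB _),
    hcp.mem_left_of_iso (D.cyclesIso s) (hZ s), ?_,
    hcp.mem_left_of_iso (D.homologyIso s) (hH s)⟩
  obtain ⟨e, he, hde⟩ := D.exists_factorization (sub_add_cancel s 1)
  have : Epi e := (ModuleCat.epi_iff_surjective _).2 he
  have : Mono (D.i s) := (ModuleCat.mono_iff_injective _).2 (D.i_injective s)
  have : Mono (D.j s) := (ModuleCat.mono_iff_injective _).2 (D.j_injective s)
  have := strongEpi_of_epi e
  exact hcp.mem_left_of_iso (image.isoStrongEpiMono e (D.i s ≫ D.j s) hde).symm (hB s)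

/-- A morphism of cochain complexes from compatible morphisms of boundaries and cycles. -/
def homMk (f : ∀ s, W.X s ⟶ W'.X s) (fB : ∀ s, D.B s ⟶ D'.B s) (fZ : ∀ s, D.Z s ⟶ D'.Z s)
    (hp : ∀ s, D.p s ≫ fB (s + 1) = f s ≫ D'.p s) (hi : ∀ s, D.i s ≫ fZ s = fB s ≫ D'.i s)
    (hj : ∀ s, D.j s ≫ f s = fZ s ≫ D'.j s) : W ⟶ W' where
  f := f
  comm' s t hst := by
    obtain rfl : s + 1 = t := hst
    rw [D.d_eq, D'.d_eq, ← reassoc_of% hp, ← reassoc_of% hi, Category.assoc, Category.assoc, hj]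

section assemble

variable {B Z H V : ℤ → ModuleCat.{u} R} {i : ∀ s, B s ⟶ Z s} {π : ∀ s, Z s ⟶ H s}
  {j : ∀ s, Z s ⟶ V s} {p : ∀ s, V s ⟶ B (s + 1)} (hiπ : ∀ s, IsSES (i s) (π s))
  (hjp : ∀ s, IsSES (j s) (p s))

/-- The cochain complex assembled from its boundaries, cycles and cohomology. -/
def assemble (i : ∀ s, B s ⟶ Z s) (hjp : ∀ s, IsSES (j s) (p s)) :
    CochainComplex (ModuleCat.{u} R) ℤ :=
  CochainComplex.of V (fun s => p s ≫ i (s + 1) ≫ j (s + 1))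
    (fun s => by simp [reassoc_of% (hjp (s + 1)).zero])

/-- The boundaries, cycles and cohomology of an assembled cochain complex. -/
def ofAssemble : CEData (assemble i hjp) where
  B := B
  Z := Z
  H := H
  i := i
  π := π
  j := j
  p := p
  ses_iπ := hiπ
  ses_jp := hjp
  d_eq s := CochainComplex.of_d V (fun s => p s ≫ i (s + 1) ≫ j (s + 1)) s

end assemble

end CEData

/-- Every cochain complex embeds, injectively in cohomology, into a complex with boundaries and
cohomology in the right class of the cotorsion pair, with a CE complex as its cokernel. -/
theorem exists_shortExact [HasExt.{w} (ModuleCat.{u} R)] {A B : Set (ModuleCat.{u} R)}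
    (hcp : IsCotorsionPair A B) (hcomplete : IsCompleteCP A B) (hhered : IsHereditaryCP A B)
    (C : CochainComplex (ModuleCat.{u} R) ℤ) :
    ∃ S : ShortComplex (CochainComplex (ModuleCat.{u} R) ℤ), S.X₁ = C ∧ S.ShortExact ∧
      (∀ s, Mono (HomologicalComplex.homologyMap S.f s)) ∧ IsCE A S.X₃ ∧
      ∃ D : CEData S.X₂, (∀ s, D.B s ∈ B) ∧ ∀ s, D.H s ∈ B := by
  let D := CEData.canonical C
  choose B' B'' b b' hB' hB'' hb using fun s => (hcomplete (D.B s)).2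
  choose H' H'' h h' hH' hH'' hh using fun s => (hcomplete (D.H s)).2
  choose Z' Z'' z z' i' π' i'' π'' hz hiπ' hiπ'' comm_i comm_π comm_i' comm_π' using fun s =>
    hcp.horseshoe hhered (D.ses_iπ s) (hb s) (hh s) (hB' s) (hH'' s)
  have hZ' (s : ℤ) : Z' s ∈ B := hcp.right_of_extension (hiπ' s) (hB' s) (hH' s)
  choose V' V'' v v' j' p' j'' p'' hv hjp' hjp'' comm_j comm_p comm_j' comm_p' using fun s =>
    hcp.horseshoe hhered (D.ses_jp s) (hz s) (hb (s + 1)) (hZ' s) (hB'' (s + 1))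
  let D' := CEData.ofAssemble hiπ' hjp'
  let D'' := CEData.ofAssemble hiπ'' hjp''
  let φ := D.homMk D' v b z comm_p comm_i comm_j
  let ψ := D'.homMk D'' v' b' z' comm_p' comm_i' comm_j'
  have w : φ ≫ ψ = 0 := by
    ext1 s
    exact (hv s).zero
  refine ⟨ShortComplex.mk φ ψ w, rfl,
    HomologicalComplex.shortExact_of_degreewise_shortExact _ fun s => (hv s).shortExact,
    fun s => ?_, D''.isCE hcp hB'' hH'', D', hB', hH'⟩
  rw [D.homologyMap_eq D' φ s (z s) (h s) (comm_j s) (comm_π s)]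
  exact mono_comp' inferInstance
    (mono_comp' ((ModuleCat.mono_iff_injective _).2 (hh s).1) inferInstance)

end CartanEilenberg

theorem ghostTriangle_of_mono {X Y Z : DerivedCategory (ModuleCat.{u} R)} {f : X ⟶ Y} {g : Y ⟶ Z}
    {h : Z ⟶ X⟦(1 : ℤ)⟧}
    (hT : Triangle.mk f g h ∈ distTriang (DerivedCategory (ModuleCat.{u} R)))
    (hf : ∀ s, Mono ((homologyFunctor (ModuleCat.{u} R) s).map f)) : GhostTriangle f g h := by
  refine ⟨hT, fun s => ⟨(ModuleCat.mono_iff_injective _).1 (hf s),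
    (ModuleCat.epi_iff_surjective _).1 ?_, ?_⟩⟩
  · exact (HomologySequence.epi_homologyMap_mor₂_iff _ hT s (s + 1)).2
      ((HomologySequence.mono_homologyMap_mor₁_iff _ hT s (s + 1)).1 (hf (s + 1)))
  · exact (ShortComplex.ShortExact.moduleCat_exact_iff_function_exact _).1
      (HomologySequence.exact₂ _ hT s)

theorem exists_ghostTriangle_of_shortExact
    {S : ShortComplex (CochainComplex (ModuleCat.{u} R) ℤ)} (hS : S.ShortExact)
    (hmono : ∀ s, Mono (HomologicalComplex.homologyMap S.f s))
    {C : DerivedCategory (ModuleCat.{u} R)} (e : Q.obj S.X₁ ≅ C) :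
    ∃ (f : C ⟶ Q.obj S.X₂) (g : Q.obj S.X₂ ⟶ Q.obj S.X₃) (h : Q.obj S.X₃ ⟶ C⟦(1 : ℤ)⟧),
      GhostTriangle f g h := by
  refine ⟨e.inv ≫ Q.map S.f, Q.map S.g, triangleOfSESδ hS ≫ e.hom⟦1⟧',
    ghostTriangle_of_mono (isomorphic_distinguished _ (triangleOfSES_distinguished hS) _
      (Triangle.isoMk _ _ e.symm (Iso.refl _) (Iso.refl _) ?_ ?_ ?_)) fun s => ?_⟩
  · exact Category.comp_id _
  · exact (Category.comp_id _).trans (Category.id_comp _).symm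
  · have : (triangleOfSESδ hS ≫ e.hom⟦1⟧') ≫ e.inv⟦1⟧' = triangleOfSESδ hS := by
      simp [← Functor.map_comp]
    exact this.trans (Category.id_comp _).symm
  · have := NatIso.naturality_2 (homologyFunctorFactors (ModuleCat.{u} R) s) S.f
    rw [Functor.map_comp]
    refine mono_comp' (IsIso.mono_of_iso _) ?_
    rw [← Functor.comp_map, ← this]
    exact mono_comp' (IsIso.mono_of_iso _) (mono_comp' (hmono s) (IsIso.mono_of_iso _))

section ProjectiveComplexes

omit [HasDerivedCategory.{w} (ModuleCat.{u} R)]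

variable {P W : CochainComplex (ModuleCat.{u} R) ℤ}

theorem canonical_B_mem_left [HasExt.{w} (ModuleCat.{u} R)] {A B : Set (ModuleCat.{u} R)}
    (hcp : IsCotorsionPair A B) (hhered : IsHereditaryCP A B) (hP : ∀ n, Projective (P.X n))
    (hP₀ : ∀ n, 0 < n → IsZero (P.X n)) (hPA : ∀ n, P.homology n ∈ A) (n : ℤ) :
    (CEData.canonical P).B n ∈ A := by
  let D := CEData.canonical P
  have hpos (n : ℤ) (hn : 0 < n) : D.B n ∈ A := by
    have : Mono (D.i n ≫ D.j n) := (ModuleCat.mono_iff_injective _).2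
      ((D.j_injective n).comp (D.i_injective n))
    exact hcp.mem_left_of_isZero ((hP₀ n hn).of_mono (D.i n ≫ D.j n))
  obtain hn | hn := lt_or_ge 0 n
  · exact hpos n hn
  · have hstep (n : ℤ) (hn : D.B (n + 1) ∈ A) : D.B n ∈ A :=
      hhered.1 _ _ _ _ _ (hhered.1 _ _ _ _ _ (hcp.mem_left_of_projective) hn (D.ses_jp n))
        (hPA n) (D.ses_iπ n)
    induction n, hn using Int.leInductionDown with
    | base => exact hstep 0 (hpos _ (by simp))
    | pred n hn ih => exact hstep (n - 1) (by rwa [sub_add_cancel])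

theorem exists_factorization_d [HasExt.{w} (ModuleCat.{u} R)] {A B : Set (ModuleCat.{u} R)}
    (hcp : IsCotorsionPair A B) (hhered : IsHereditaryCP A B) (hP : ∀ n, Projective (P.X n))
    (hP₀ : ∀ n, 0 < n → IsZero (P.X n)) (hPA : ∀ n, P.homology n ∈ A) {m n : ℤ} (hmn : m + 1 = n)
    (hPm : IsZero (P.homology m)) {N : ModuleCat.{u} R} (hN : N ∈ B) (v : P.X m ⟶ N)
    (hv : ∀ l, P.d l m ≫ v = 0) : ∃ h : P.X n ⟶ N, P.d m n ≫ h = v := by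
  subst hmn
  let D := CEData.canonical P
  have hB := canonical_B_mem_left hcp hhered hP hP₀ hPA
  obtain ⟨v', hv'⟩ := (D.ses_jp m).exists_desc v (by
    obtain ⟨e, he, hed⟩ := D.exists_factorization (sub_add_cancel m 1)
    have : Epi e := (ModuleCat.epi_iff_surjective _).2 he
    have : IsIso (D.i m) := by
      have := (D.ses_iπ m).shortExact.isIso_f_iff
      exact this.2 hPm
    rw [← cancel_epi (D.i m), ← cancel_epi e, comp_zero, comp_zero, ← Category.assoc (D.i m),
      ← Category.assoc e, hed, hv])
  obtain ⟨v'', hv''⟩ := hcp.exists_extension (D.ses_iπ (m + 1)) (hPA (m + 1)) hN v'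
  obtain ⟨h, hh⟩ := hcp.exists_extension (D.ses_jp (m + 1)) (hB _) hN v''
  exact ⟨h, by rw [D.d_eq, Category.assoc, Category.assoc, hh, hv'', hv']⟩

/-- Boundaries and cycles of the cochain complex lie in `B`. -/
def HasBoundariesAndCycles (B : Set (ModuleCat.{u} R)) (W : CochainComplex (ModuleCat.{u} R) ℤ) :
    Prop :=
  ∀ r s t : ℤ, r + 1 = s → s + 1 = t → ∃ (M Z : ModuleCat.{u} R) (p : W.X r ⟶ M) (i : M ⟶ Z)
    (j : Z ⟶ W.X s), M ∈ B ∧ Z ∈ B ∧ Function.Surjective p ∧ Function.Injective i ∧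
      Function.Injective j ∧ p ≫ i ≫ j = W.d r s ∧ Function.Exact j (W.d s t)

theorem CEData.hasBoundariesAndCycles [HasExt.{w} (ModuleCat.{u} R)] {A B : Set (ModuleCat.{u} R)}
    (hcp : IsCotorsionPair A B) (D : CEData W) (hB : ∀ s, D.B s ∈ B) (hH : ∀ s, D.H s ∈ B) :
    HasBoundariesAndCycles B W := by
  intro r s t hr ht
  obtain ⟨e, he, hde⟩ := D.exists_factorization hr
  exact ⟨D.B s, D.Z s, e, D.i s, D.j s, hB s, hcp.right_of_extension (D.ses_iπ s) (hB s) (hH s),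
    he, D.i_injective s, D.j_injective s, hde, D.exact_j_d ht⟩

theorem HasBoundariesAndCycles.shift {B : Set (ModuleCat.{u} R)} (hW : HasBoundariesAndCycles B W)
    (k : ℤ) : HasBoundariesAndCycles B (W⟦k⟧) := by
  intro r s t hr ht
  obtain ⟨M, Z, p, i, j, hM, hZ, hp, hi, hj, hd, hex⟩ :=
    hW (r + k) (s + k) (t + k) (by lia) (by lia)
  refine ⟨M, Z, k.negOnePow • p, i, j, hM, hZ, ?_, hi, hj, ?_, ?_⟩
  · intro x
    obtain ⟨y, hy⟩ := hp (k.negOnePow • x)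
    refine ⟨y, ?_⟩
    change k.negOnePow • p y = x
    rw [hy, smul_smul, Int.units_mul_self, one_smul]
  · have : (k.negOnePow • p) ≫ i ≫ j = k.negOnePow • W.d (r + k) (s + k) := by
      rw [Linear.units_smul_comp, hd]
    exact this
  · exact fun x => (smul_eq_zero_iff_eq k.negOnePow).trans (hex x)

theorem exists_homotopy_sub_nullHomotopicMap' (g : P ⟶ W)
    (k : ∀ i j, (ComplexShape.up ℤ).Rel j i → (P.X i ⟶ W.X j)) :
    Nonempty (Homotopy g (g - Homotopy.nullHomotopicMap' k)) :=
  ⟨Homotopy.equivSubZero.symm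
    ((Homotopy.ofEq (sub_sub_cancel _ _)).trans (Homotopy.nullHomotopy' k))⟩

theorem exists_homotopy_f_zero_eq_zero (g : P ⟶ W) (hP : Projective (P.X 0))
    (hP₁ : IsZero (P.X 1)) (hg : HomologicalComplex.homologyMap g 0 = 0) :
    ∃ g' : P ⟶ W, Nonempty (Homotopy g g') ∧ g'.f 0 = 0 := by
  have hl : ∃ l : P.X 0 ⟶ W.X (-1), l ≫ W.d (-1) 0 = g.f 0 := by
    let D := CEData.canonical W
    have : IsIso (P.iCycles 0) := P.isIso_iCycles 0 1 (by simp) (hP₁.eq_of_tgt _ _)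
    obtain ⟨b, hb⟩ := (D.ses_iπ 0).exists_lift
      (inv (P.iCycles 0) ≫ HomologicalComplex.cyclesMap g 0) (by
        have : (inv (P.iCycles 0) ≫ HomologicalComplex.cyclesMap g 0) ≫ W.homologyπ 0 = 0 := by
          rw [Category.assoc, ← HomologicalComplex.homologyπ_naturality, hg, comp_zero, comp_zero]
        exact this)
    obtain ⟨e, he, hed⟩ := D.exists_factorization (neg_add_cancel 1)
    have : Epi e := (ModuleCat.epi_iff_surjective _).2 he
    refine ⟨Projective.factorThru b e, ?_⟩
    rw [← hed, Projective.factorThru_comp_assoc, reassoc_of% hb]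
    exact (IsIso.inv_comp_eq _).2 (HomologicalComplex.cyclesMap_i g 0)
  obtain ⟨l, hl⟩ := hl
  have hk (i j : ℤ) (hij : (ComplexShape.up ℤ).Rel j i) :
      ∃ k : P.X i ⟶ W.X j, i = 0 → k ≫ W.d j i = g.f i := by
    by_cases hi : i = 0
    · subst hi
      obtain rfl : j = -1 := by
        have : j + 1 = 0 := hij
        lia
      exact ⟨l, fun _ => hl⟩
    · exact ⟨0, fun h => absurd h hi⟩
  choose k hk using hk
  refine ⟨_, exists_homotopy_sub_nullHomotopicMap' g k, ?_⟩
  rw [HomologicalComplex.sub_f_apply, Homotopy.nullHomotopicMap'_f (k₂ := -1) (k₀ := 1)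
    (by simp) (by simp), hk _ _ _ rfl, hP₁.eq_of_tgt (P.d 0 1) 0]
  simp

theorem exists_homotopy_comp_d_eq_zero [HasExt.{w} (ModuleCat.{u} R)] {A B : Set (ModuleCat.{u} R)}
    (hcp : IsCotorsionPair A B) (hhered : IsHereditaryCP A B) (hP : ∀ n, Projective (P.X n))
    (hP₀ : ∀ n, 0 < n → IsZero (P.X n)) (hPA : ∀ n, P.homology n ∈ A)
    (hPz : ∀ n, n ≠ 0 → IsZero (P.homology n)) (hW : HasBoundariesAndCycles B W) (g : P ⟶ W)
    (hg : g.f 0 = 0) :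
    ∃ g' : P ⟶ W, Nonempty (Homotopy g g') ∧ g'.f 0 = 0 ∧ ∀ m n, g'.f m ≫ W.d m n = 0 := by
  have hk (i j : ℤ) (hij : (ComplexShape.up ℤ).Rel j i) : ∃ k : P.X i ⟶ W.X j,
      P.d j i ≫ k ≫ W.d j i = g.f j ≫ W.d j i ∧ (i = 0 → k = 0) := by
    obtain rfl | hi := eq_or_ne i 0
    · exact ⟨0, by simp [g.comm, hg], fun _ => rfl⟩
    obtain rfl | hj := eq_or_ne j 0
    · exact ⟨0, by simp [hg], fun _ => rfl⟩
    obtain ⟨M, Z, p, ι, κ, hM, -, hp, hι, hκ, hd, -⟩ := hW j i (i + 1) hij rfl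
    have : Mono (ι ≫ κ) := (ModuleCat.mono_iff_injective _).2 (hκ.comp hι)
    have : Epi p := (ModuleCat.epi_iff_surjective _).2 hp
    obtain ⟨h, hh⟩ := exists_factorization_d hcp hhered hP hP₀ hPA hij (hPz j hj) hM (g.f j ≫ p)
      fun l => by
        rw [← cancel_mono (ι ≫ κ)]
        simp [hd]
    have := hP i
    refine ⟨Projective.factorThru h p, ?_, fun h => absurd h hi⟩
    rw [← hd, Projective.factorThru_comp_assoc, reassoc_of% hh]
  choose k hk hk₀ using hk
  refine ⟨_, exists_homotopy_sub_nullHomotopicMap' g k, ?_, fun m n => ?_⟩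
  · rw [HomologicalComplex.sub_f_apply, Homotopy.nullHomotopicMap'_f (k₂ := -1) (k₀ := 1)
      (by simp) (by simp), hk₀ _ _ _ rfl, hg, (hP₀ 1 one_pos).eq_of_tgt (P.d 0 1) 0]
    simp
  · by_cases hmn : (ComplexShape.up ℤ).Rel m n
    · rw [HomologicalComplex.sub_f_apply, Homotopy.nullHomotopicMap'_f (k₂ := m - 1) (k₀ := n)
        (by simp) hmn]
      simp [hk]
    · rw [W.shape _ _ hmn, comp_zero]

theorem nonempty_homotopy_zero_of_comp_d_eq_zero [HasExt.{w} (ModuleCat.{u} R)]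
    {A B : Set (ModuleCat.{u} R)}
    (hcp : IsCotorsionPair A B) (hhered : IsHereditaryCP A B) (hP : ∀ n, Projective (P.X n))
    (hP₀ : ∀ n, 0 < n → IsZero (P.X n)) (hPA : ∀ n, P.homology n ∈ A)
    (hPz : ∀ n, n ≠ 0 → IsZero (P.homology n)) (hW : HasBoundariesAndCycles B W) (g : P ⟶ W)
    (hg : g.f 0 = 0) (hgd : ∀ m n, g.f m ≫ W.d m n = 0) : Nonempty (Homotopy g 0) := by
  have hk (i j : ℤ) (hij : (ComplexShape.up ℤ).Rel j i) : ∃ k : P.X i ⟶ W.X j,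
      P.d j i ≫ k = g.f j ∧ ∀ n, k ≫ W.d j n = 0 := by
    obtain rfl | hj := eq_or_ne j 0
    · exact ⟨0, by simp [hg], by simp⟩
    obtain ⟨M, Z, p, ι, κ, -, hZ, -, -, hκ, -, hex⟩ := hW (j - 1) j i (sub_add_cancel j 1) hij
    have : Mono κ := (ModuleCat.mono_iff_injective _).2 hκ
    obtain ⟨v, hv⟩ := exists_lift_of_range_le hκ (g.f j) fun x =>
      (hex _).1 (ConcreteCategory.congr_hom (hgd j i) x)
    obtain ⟨h, hh⟩ := exists_factorization_d hcp hhered hP hP₀ hPA hij (hPz j hj) hZ v fun l => by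
      rw [← cancel_mono κ, Category.assoc, hv, ← g.comm, hgd, zero_comp]
    refine ⟨h ≫ κ, by rw [reassoc_of% hh, hv], fun n => ?_⟩
    by_cases hn : (ComplexShape.up ℤ).Rel j n
    · obtain rfl : i = n := hij.symm.trans hn
      ext x
      exact (hex _).2 ⟨_, rfl⟩
    · rw [W.shape _ _ hn, comp_zero]
  choose k hk hkd using hk
  have hgk : g = Homotopy.nullHomotopicMap' k := by
    ext1 n
    rw [Homotopy.nullHomotopicMap'_f (k₂ := n - 1) (k₀ := n + 1) (by simp) (by simp), hk, hkd,
      add_zero]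
  exact ⟨(Homotopy.ofEq hgk).trans (Homotopy.nullHomotopy' k)⟩

/-- A morphism from a projective resolution of a module in `A` to a complex with boundaries and
cycles in `B` is null-homotopic as soon as it vanishes on cohomology in degree `0`. -/
theorem nonempty_homotopy_zero [HasExt.{w} (ModuleCat.{u} R)] {A B : Set (ModuleCat.{u} R)}
    (hcp : IsCotorsionPair A B) (hhered : IsHereditaryCP A B) (hP : ∀ n, Projective (P.X n))
    (hP₀ : ∀ n, 0 < n → IsZero (P.X n)) (hPA : ∀ n, P.homology n ∈ A)
    (hPz : ∀ n, n ≠ 0 → IsZero (P.homology n)) (hW : HasBoundariesAndCycles B W) (g : P ⟶ W)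
    (hg : HomologicalComplex.homologyMap g 0 = 0) : Nonempty (Homotopy g 0) := by
  obtain ⟨g₁, ⟨h₁⟩, hg₁⟩ := exists_homotopy_f_zero_eq_zero g (hP 0) (hP₀ 1 one_pos) hg
  obtain ⟨g₂, ⟨h₂⟩, hg₂, hgd⟩ :=
    exists_homotopy_comp_d_eq_zero hcp hhered hP hP₀ hPA hPz hW g₁ hg₁
  obtain ⟨h₃⟩ :=
    nonempty_homotopy_zero_of_comp_d_eq_zero hcp hhered hP hP₀ hPA hPz hW g₂ hg₂ hgd
  exact ⟨h₁.trans (h₂.trans h₃)⟩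

end ProjectiveComplexes

section Stalk

theorem exists_Q_map_eq {P W : CochainComplex (ModuleCat.{u} R) ℤ} [P.IsKProjective]
    (f : Q.obj P ⟶ Q.obj W) : ∃ g : P ⟶ W, Q.map g = f := by
  obtain ⟨g, hg⟩ := (CochainComplex.IsKProjective.Qh_map_bijective P
    ((HomotopyCategory.quotient _ _).obj W)).2 ((quotientCompQhIso _).hom.app P ≫ f ≫
      (quotientCompQhIso _).inv.app W)
  obtain ⟨g, rfl⟩ := (HomotopyCategory.quotient _ _).map_surjective g
  refine ⟨g, ?_⟩
  rw [← cancel_epi ((quotientCompQhIso _).hom.app P), ← quotientCompQhIso_hom_naturality, hg]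
  simp

omit [HasDerivedCategory.{w} (ModuleCat.{u} R)] in
theorem exists_homologyMap_single_eq {M : ModuleCat.{u} R}
    {W : CochainComplex (ModuleCat.{u} R) ℤ} (z : M ⟶ W.cycles 0) :
    ∃ F : (HomologicalComplex.single (ModuleCat.{u} R) (ComplexShape.up ℤ) 0).obj M ⟶ W,
      HomologicalComplex.homologyMap F 0 =
        (HomologicalComplex.singleObjHomologySelfIso _ 0 M).hom ≫ z ≫ W.homologyπ 0 := by
  let F := HomologicalComplex.mkHomFromSingle (c := .up ℤ) (j := 0) (z ≫ W.iCycles 0) (by simp)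
  have hF : HomologicalComplex.cyclesMap F 0 =
      (HomologicalComplex.singleObjCyclesSelfIso _ _ _).hom ≫ z := by
    rw [← cancel_mono (W.iCycles 0), HomologicalComplex.cyclesMap_i, Category.assoc,
      HomologicalComplex.mkHomFromSingle_f, HomologicalComplex.singleObjCyclesSelfIso_hom,
      Category.assoc]
  refine ⟨F, ?_⟩
  rw [← cancel_epi (HomologicalComplex.homologyπ _ _), HomologicalComplex.homologyπ_naturality,
    HomologicalComplex.homologyπ_singleObjHomologySelfIso_hom_assoc, hF, Category.assoc]

omit [HasDerivedCategory.{w} (ModuleCat.{u} R)] in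
theorem exists_comp_homologyπ_eq_of_leftHomologyData {S : ShortComplex (ModuleCat.{u} R)}
    (h : S.LeftHomologyData) {M : ModuleCat.{u} R} (y : M ⟶ S.homology)
    (hz : ∃ z : M ⟶ h.K, z ≫ h.π = y ≫ h.homologyIso.hom) :
    ∃ z : M ⟶ S.cycles, z ≫ S.homologyπ = y := by
  obtain ⟨z, hz⟩ := hz
  refine ⟨z ≫ h.cyclesIso.inv, ?_⟩
  rw [Category.assoc, ← h.π_comp_homologyIso_inv, reassoc_of% hz, Iso.hom_inv_id, Category.comp_id]

variable [HasExt.{w} (ModuleCat.{u} R)] {A B : Set (ModuleCat.{u} R)}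
  (hcp : IsCotorsionPair A B) {M : ModuleCat.{u} R} (hM : M ∈ A)
  {W : CochainComplex (ModuleCat.{u} R) ℤ} (hW : HasBoundariesAndCycles B W)

include hcp hM hW

theorem eq_zero_of_homologyFunctor_map_eq_zero (hhered : IsHereditaryCP A B)
    (f : Q.obj ((HomologicalComplex.single (ModuleCat.{u} R) (ComplexShape.up ℤ) 0).obj M) ⟶
      Q.obj W) (hf : (homologyFunctor (ModuleCat.{u} R) 0).map f = 0) : f = 0 := by
  let T := projectiveResolution M
  let P := T.cochainComplex
  have : P.IsKProjective := P.isKProjective_of_projective 0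
  let q : P ⟶ (HomologicalComplex.single (ModuleCat.{u} R) (ComplexShape.up ℤ) 0).obj M := T.π'
  have hq : QuasiIso q := inferInstanceAs (QuasiIso T.π')
  have hPz (n : ℤ) (hn : n ≠ 0) : IsZero (P.homology n) :=
    (HomologicalComplex.isZero_single_obj_homology _ _ M n hn).of_iso
      (isoOfQuasiIsoAt q n)
  have hPA (n : ℤ) : P.homology n ∈ A := by
    obtain rfl | hn := eq_or_ne n 0
    · exact hcp.mem_left_of_iso (isoOfQuasiIsoAt q 0 ≪≫
        HomologicalComplex.singleObjHomologySelfIso _ _ M) hM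
    · exact hcp.mem_left_of_isZero (hPz n hn)
  obtain ⟨g, hg⟩ := exists_Q_map_eq (Q.map q ≫ f)
  have hg₀ : HomologicalComplex.homologyMap g 0 = 0 := by
    have h₀ : (Q ⋙ homologyFunctor (ModuleCat.{u} R) 0).map g = 0 := by
      rw [Functor.comp_map, hg, Functor.map_comp, hf]
      exact comp_zero
    refine (NatIso.naturality_1 (homologyFunctorFactors (ModuleCat.{u} R) 0) g).symm.trans ?_
    rw [h₀, zero_comp]
    exact comp_zero
  obtain ⟨hg'⟩ := nonempty_homotopy_zero hcp hhered
    (fun n => inferInstanceAs (Projective (T.cochainComplex.X n)))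
    (fun n hn => T.cochainComplex.isZero_of_isStrictlyLE 0 n hn) hPA hPz hW g hg₀
  rw [← cancel_epi (Q.map q), ← hg, Q_map_eq_of_homotopy _ hg', Functor.map_zero, comp_zero]

omit [HasDerivedCategory.{w} (ModuleCat.{u} R)] in
theorem exists_comp_homologyπ_eq (y : M ⟶ W.homology 0) :
    ∃ z : M ⟶ W.cycles 0, z ≫ W.homologyπ 0 = y := by
  obtain ⟨N, Z, p, ι, κ, hN, -, hp, hι, hκ, hd, hex⟩ := hW _ _ _
    (show (ComplexShape.up ℤ).prev 0 + 1 = 0 by simp)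
    (show 0 + 1 = (ComplexShape.up ℤ).next (0 : ℤ) by simp)
  have hc := IsSES.cokernel hι
  let h := leftHomologyDataOfIsSES (S := W.sc 0) hκ hex hc ⟨p, hp, hd⟩
  obtain ⟨z, hz⟩ := hcp.exists_lift hc hN hM (y ≫ h.homologyIso.hom)
  exact exists_comp_homologyπ_eq_of_leftHomologyData h y ⟨z, hz⟩

theorem exists_homologyFunctor_map_eq
    (x : (Q ⋙ homologyFunctor (ModuleCat.{u} R) 0).obj
      ((HomologicalComplex.single (ModuleCat.{u} R) (ComplexShape.up ℤ) 0).obj M) ⟶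
        (Q ⋙ homologyFunctor (ModuleCat.{u} R) 0).obj W) :
    ∃ F, (Q ⋙ homologyFunctor (ModuleCat.{u} R) 0).map F = x := by
  let α := homologyFunctorFactors (ModuleCat.{u} R) 0
  obtain ⟨z, hz⟩ := exists_comp_homologyπ_eq hcp hM hW
    ((HomologicalComplex.singleObjHomologySelfIso (ComplexShape.up ℤ) 0 M).inv ≫
      α.inv.app _ ≫ x ≫ α.hom.app W)
  obtain ⟨F, hF⟩ := exists_homologyMap_single_eq z
  refine ⟨F, ?_⟩
  refine (NatIso.naturality_2 α F).symm.trans ?_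
  rw [HomologicalComplex.homologyFunctor_map, hF, hz, Iso.hom_inv_id_assoc]
  have conj {X X' Y Y' : ModuleCat.{u} R} (a : X ≅ X') (b : Y ≅ Y') (t : X ⟶ Y) :
      a.hom ≫ (a.inv ≫ t ≫ b.hom) ≫ b.inv = t := by simp
  exact conj (α.app _) (α.app W) x

theorem homologyFunctor_map_bijective (hhered : IsHereditaryCP A B)
    {V : DerivedCategory (ModuleCat.{u} R)} (e : V ≅ Q.obj W) :
    Function.Bijective
      (fun f : Q.obj ((HomologicalComplex.single (ModuleCat.{u} R) (ComplexShape.up ℤ) 0).obj M) ⟶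
          V =>
        (homologyFunctor (ModuleCat.{u} R) 0).map f) := by
  refine ⟨fun f f' hf => ?_, fun x => ?_⟩
  · rw [← sub_eq_zero, ← cancel_mono e.hom, zero_comp]
    refine eq_zero_of_homologyFunctor_map_eq_zero hcp hM hW hhered _ ?_
    rw [Functor.map_comp, Functor.map_sub, sub_eq_zero.2 hf, zero_comp]
  · obtain ⟨F, hF⟩ := exists_homologyFunctor_map_eq hcp hM hW
      (x ≫ (homologyFunctor (ModuleCat.{u} R) 0).map e.hom)
    refine ⟨Q.map F ≫ e.inv, ?_⟩
    rw [← cancel_mono ((homologyFunctor (ModuleCat.{u} R) 0).map e.hom), ← hF, ← Functor.map_comp,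
      Category.assoc, e.inv_hom_id, Category.comp_id, Functor.comp_map]

end Stalk

theorem deltaMap_bijective [HasExt.{w} (ModuleCat.{u} R)] {A B : Set (ModuleCat.{u} R)}
    (hcp : IsCotorsionPair A B) (hhered : IsHereditaryCP A B) {M : ModuleCat.{u} R} (hM : M ∈ A)
    {W : CochainComplex (ModuleCat.{u} R) ℤ} (hW : HasBoundariesAndCycles B W) (s : ℤ) :
    Function.Bijective (deltaMap M (Q.obj W) s) := by
  have h := homologyFunctor_map_bijective hcp hM (hW.shift s) hhered
    ((Q.commShiftIso s).app W).symm
  exact ((stalkHomologyIso M).homCongr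
    (shiftHomologyIso (Q.obj W) s 0 s (add_zero s))).bijective.comp h

theorem stmt1 [HasExt.{w} (ModuleCat.{u} R)]
    (A B : Set (ModuleCat.{u} R))
    (hcp : IsCotorsionPair A B) (hcomplete : IsCompleteCP A B) (hhered : IsHereditaryCP A B)
    (C : DerivedCategory (ModuleCat.{u} R)) :
    ∃ (Y' X' : DerivedCategory (ModuleCat.{u} R))
      (f : C ⟶ Y') (g : Y' ⟶ X') (h : X' ⟶ C⟦(1:ℤ)⟧),
      GhostTriangle f g h ∧
      (∃ Xc : CochainComplex (ModuleCat.{u} R) ℤ,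
        IsCE A Xc ∧ Nonempty (X' ≅ DerivedCategory.Q.obj Xc)) ∧
      (∀ s : ℤ, (homologyFunctor (ModuleCat.{u} R) s).obj Y' ∈ B) ∧
      (∀ A' ∈ A, ∀ s : ℤ, Function.Bijective (deltaMap A' Y' s)) := by
  obtain ⟨S, hS₁, hS, hmono, hCE, D, hB, hH⟩ :=
    exists_shortExact hcp hcomplete hhered (Q.objPreimage C)
  obtain ⟨f, g, h, hT⟩ := exists_ghostTriangle_of_shortExact hS hmono
    (eqToIso (congrArg Q.obj hS₁) ≪≫ Q.objObjPreimageIso C)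
  exact ⟨_, _, f, g, h, hT, ⟨S.X₃, hCE, ⟨Iso.refl _⟩⟩,
    fun s => hcp.mem_right_of_iso
      ((homologyFunctorFactors (ModuleCat.{u} R) s).app S.X₂ ≪≫ D.homologyIso s) (hH s),
    fun A' hA' s => deltaMap_bijective hcp hhered hA' (D.hasBoundariesAndCycles hcp hB hH) s⟩
end
end

section
/- Let R be an associative ring with identity and let (A,B) be a complete hereditary cotorsion pair in Mod R. Call an object X of D(R) an A_P-object if for every s ∈ ℤ the module H^s(X) lies in A, and for every B ∈ B and every s ∈ ℤ the canonical map γ_s : Hom_{D(R)}(X, S(B)⟦s⟧) → Hom_R(H^{-s}(X), B) is bijective. If X₁ → X₂ → X₃ → X₁⟦1⟧ is a cohomologically ghost distinguished triangle in D(R) and X₂ and X₃ are A_P-objects, then X₁ is an A_P-object. (Heredity part of Theorem 2.5, A-side.) -/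
open CategoryTheory Limits DerivedCategory Pretriangulated

noncomputable section

universe w u

variable {R : Type u} [Ring R]

variable [HasDerivedCategory.{w} (ModuleCat.{u} R)]

def gammaMap (X : DerivedCategory (ModuleCat.{u} R)) (M : ModuleCat.{u} R) (s : ℤ)
    (f : X ⟶ (stalk M)⟦s⟧) : (homologyFunctor (ModuleCat.{u} R) (-s)).obj X ⟶ M :=
  (homologyFunctor (ModuleCat.{u} R) (-s)).map f ≫
    (shiftHomologyIso (stalk M) s (-s) 0 (by ring)).hom ≫ (stalkHomologyIso M).hom

def IsAPObject [HasExt.{w} (ModuleCat.{u} R)] (A B : Set (ModuleCat.{u} R))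
    (X : DerivedCategory (ModuleCat.{u} R)) : Prop :=
  (∀ s : ℤ, (homologyFunctor (ModuleCat.{u} R) s).obj X ∈ A) ∧
  ∀ N ∈ B, ∀ s : ℤ, Function.Bijective (gammaMap X N s)

set_option linter.unusedSectionVars false

theorem IsSES.shortExact_s2 {K M N : ModuleCat.{u} R} {i : K ⟶ M} {p : M ⟶ N} (h : IsSES i p)
    (w : i ≫ p = 0) : (ShortComplex.mk i p w).ShortExact :=
  ModuleCat.shortComplex_shortExact _ h.2.2 h.1 h.2.1

theorem IsSES.comp_eq_zero {K M N : ModuleCat.{u} R} {i : K ⟶ M} {p : M ⟶ N} (h : IsSES i p) :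
    i ≫ p = 0 := by
  ext x
  exact h.2.2.apply_apply_eq_zero x

theorem IsSES.exists_extension [HasExt.{w} (ModuleCat.{u} R)] {K M N L : ModuleCat.{u} R}
    {i : K ⟶ M} {p : M ⟶ N} (h : IsSES i p) (hL : Ext1Zero N L) (φ : K ⟶ L) :
    ∃ ψ : M ⟶ L, i ≫ ψ = φ := by
  have hL' : Subsingleton (Abelian.Ext N L 1) := hL
  obtain ⟨x, hx⟩ := Abelian.Ext.contravariant_sequence_exact₁ (h.shortExact_s2 h.comp_eq_zero) L
    (Abelian.Ext.mk₀ φ) (n₁ := 1) rfl (Subsingleton.elim _ _)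
  obtain ⟨ψ, rfl⟩ := (Abelian.Ext.mk₀_bijective M L).2 x
  refine ⟨ψ, (Abelian.Ext.mk₀_bijective K L).1 ?_⟩
  rw [← hx, Abelian.Ext.mk₀_comp_mk₀]

theorem IsSES.exists_desc_s2 {K M N L : ModuleCat.{u} R} {i : K ⟶ M} {p : M ⟶ N} (h : IsSES i p)
    (ψ : M ⟶ L) (hψ : i ≫ ψ = 0) : ∃ χ : N ⟶ L, p ≫ χ = ψ := by
  have hS := h.shortExact_s2 h.comp_eq_zero
  have := hS.epi_g
  exact ⟨hS.exact.desc ψ hψ, hS.exact.g_desc ψ hψ⟩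

theorem gammaMap_comp {X Y : DerivedCategory (ModuleCat.{u} R)} (f : X ⟶ Y) (M : ModuleCat.{u} R)
    (s : ℤ) (y : Y ⟶ (stalk M)⟦s⟧) :
    gammaMap X M s (f ≫ y) = (homologyFunctor (ModuleCat.{u} R) (-s)).map f ≫ gammaMap Y M s y := by
  simp [gammaMap]

theorem gammaMap_zero (X : DerivedCategory (ModuleCat.{u} R)) (M : ModuleCat.{u} R) (s : ℤ) :
    gammaMap X M s 0 = 0 := by
  simp [gammaMap]

theorem gammaMap_eq_zero_of_map_eq_zero {X Y : DerivedCategory (ModuleCat.{u} R)} (f : X ⟶ Y)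
    (M : ModuleCat.{u} R) (s : ℤ) (y : Y ⟶ (stalk M)⟦s⟧)
    (hf : (homologyFunctor (ModuleCat.{u} R) (-s)).map f = 0) : gammaMap X M s (f ≫ y) = 0 := by
  rw [gammaMap_comp, hf, zero_comp]

section

variable {X Y Z : DerivedCategory (ModuleCat.{u} R)} {f : X ⟶ Y} {g : Y ⟶ Z} {h : Z ⟶ X⟦(1 : ℤ)⟧}

theorem GhostTriangle.isSES (hT : GhostTriangle f g h) (s : ℤ) :
    IsSES ((homologyFunctor (ModuleCat.{u} R) s).map f)
      ((homologyFunctor (ModuleCat.{u} R) s).map g) :=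
  hT.2 s

theorem GhostTriangle.map_connecting_eq_zero (hT : GhostTriangle f g h) (s : ℤ) :
    (homologyFunctor (ModuleCat.{u} R) s).map h = 0 := by
  have hg : Epi ((homologyFunctor (ModuleCat.{u} R) s).map g) :=
    (ModuleCat.epi_iff_surjective _).2 (hT.2 s).2.1
  have hgh : g ≫ h = 0 := comp_distTriang_mor_zero₂₃ _ hT.1
  rw [← cancel_epi ((homologyFunctor (ModuleCat.{u} R) s).map g), ← Functor.map_comp, hgh,
    Functor.map_zero, comp_zero]

/-- The obstruction to extending `x` along `f` is the composite of `h` with the shift of `x`. -/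
theorem exists_extension_of_distTriang
    (hT : Triangle.mk f g h ∈ distTriang (DerivedCategory (ModuleCat.{u} R)))
    {S : DerivedCategory (ModuleCat.{u} R)} (x : X ⟶ S) (hx : h ≫ x⟦(1 : ℤ)⟧' = 0) :
    ∃ y : Y ⟶ S, f ≫ y = x := by
  obtain ⟨y', hy'⟩ : ∃ y' : Y⟦(1 : ℤ)⟧ ⟶ S⟦(1 : ℤ)⟧, x⟦(1 : ℤ)⟧' = (-f⟦(1 : ℤ)⟧') ≫ y' :=
    Triangle.yoneda_exact₃ _ (rot_of_distTriang _ hT) (x⟦(1 : ℤ)⟧') hx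
  obtain ⟨y, rfl⟩ := (shiftFunctor (DerivedCategory (ModuleCat.{u} R)) (1 : ℤ)).map_surjective y'
  refine ⟨-y, (shiftFunctor (DerivedCategory (ModuleCat.{u} R)) (1 : ℤ)).map_injective ?_⟩
  rw [hy']
  simp

theorem GhostTriangle.exists_extension (hT : GhostTriangle f g h) {M : ModuleCat.{u} R} {s : ℤ}
    (hZ : Function.Injective (gammaMap Z M (s + 1))) (x : X ⟶ (stalk M)⟦s⟧) :
    ∃ y : Y ⟶ (stalk M)⟦s⟧, f ≫ y = x := by
  refine exists_extension_of_distTriang hT.1 x ?_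
  let e := (shiftFunctorAdd (DerivedCategory (ModuleCat.{u} R)) s 1).app (stalk M)
  rw [← cancel_mono e.inv, zero_comp, Category.assoc]
  apply hZ
  rw [gammaMap_zero]
  exact gammaMap_eq_zero_of_map_eq_zero h M (s + 1) _ (hT.map_connecting_eq_zero _)

theorem GhostTriangle.gammaMap_surjective [HasExt.{w} (ModuleCat.{u} R)]
    (hT : GhostTriangle f g h) {M : ModuleCat.{u} R} {s : ℤ}
    (hExt : Ext1Zero ((homologyFunctor (ModuleCat.{u} R) (-s)).obj Z) M)
    (hY : Function.Surjective (gammaMap Y M s)) : Function.Surjective (gammaMap X M s) := by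
  intro φ
  obtain ⟨ψ, rfl⟩ := (hT.isSES (-s)).exists_extension hExt φ
  obtain ⟨y, rfl⟩ := hY ψ
  exact ⟨f ≫ y, gammaMap_comp f M s y⟩

theorem gammaMap_injective_of_map_zero {X : DerivedCategory (ModuleCat.{u} R)}
    {M : ModuleCat.{u} R} {s : ℤ} (hX : ∀ x, gammaMap X M s x = 0 → x = 0) :
    Function.Injective (gammaMap X M s) := by
  intro x x' hxx'
  refine sub_eq_zero.1 (hX _ ?_)
  rw [← sub_eq_zero] at hxx'
  simpa [gammaMap] using hxx'

theorem GhostTriangle.gammaMap_injective (hT : GhostTriangle f g h) {M : ModuleCat.{u} R} {s : ℤ}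
    (hY : Function.Injective (gammaMap Y M s)) (hZ : Function.Surjective (gammaMap Z M s))
    (hZ' : Function.Injective (gammaMap Z M (s + 1))) : Function.Injective (gammaMap X M s) := by
  refine gammaMap_injective_of_map_zero fun x hx => ?_
  obtain ⟨y, rfl⟩ := hT.exists_extension hZ' x
  rw [gammaMap_comp] at hx
  obtain ⟨χ, hχ⟩ := (hT.isSES (-s)).exists_desc_s2 _ hx
  obtain ⟨z, rfl⟩ := hZ χ
  have hfg : f ≫ g = 0 := comp_distTriang_mor_zero₁₂ _ hT.1
  rw [← gammaMap_comp] at hχ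
  rw [← hY hχ, ← Category.assoc, hfg, zero_comp]

end

theorem stmt2 [HasExt.{w} (ModuleCat.{u} R)]
    (A B : Set (ModuleCat.{u} R))
    (hcp : IsCotorsionPair A B) (hcomplete : IsCompleteCP A B) (hhered : IsHereditaryCP A B)
    (X₁ X₂ X₃ : DerivedCategory (ModuleCat.{u} R))
    (f : X₁ ⟶ X₂) (g : X₂ ⟶ X₃) (h : X₃ ⟶ X₁⟦(1:ℤ)⟧)
    (hT : GhostTriangle f g h)
    (h₂ : IsAPObject A B X₂) (h₃ : IsAPObject A B X₃) :
    IsAPObject A B X₁ := by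
  refine ⟨fun s => hhered.1 _ _ _ _ _ (h₂.1 s) (h₃.1 s) (hT.isSES s), fun N hN s => ⟨?_, ?_⟩⟩
  · exact hT.gammaMap_injective (h₂.2 N hN s).1 (h₃.2 N hN s).2 (h₃.2 N hN (s + 1)).1
  · exact hT.gammaMap_surjective ((hcp.1 _).1 (h₃.1 (-s)) N hN) (h₂.2 N hN s).2
end
end
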